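/- Let (A, {,}) be a Lie superalgebra and r ∈ A⊗A a homogeneous element of even total parity. The map δ(x) = (ad(x)⊗id + (-1)^{|x||r1|} id⊗ad(x))r makes (A, δ) into a Lie supercoalgebra if and only if for all x: (ad(x)⊗id + (-1)^{|x||r1|} id⊗ad(x))(r + τ(r)) = 0 and ad(x)([r12,r13] + [r12,r23] + [r13,r23]) = 0. -/

import Mathlib

open TensorProduct

/-- The Koszul sign `(-1)^{ij}` for parities `i j : ZMod 2`. -/
def sgn (K : Type) [Field K] (i j : ZMod 2) : K := (-1 : K) ^ (i.val * j.val)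

/-- The image of `p ⊗ q` inside `A ⊗ A`. -/
noncomputable def tsub (K : Type) [Field K] {A : Type} [AddCommGroup A] [Module K A]
    (p q : Submodule K A) : Submodule K (A ⊗[K] A) :=
  LinearMap.range (TensorProduct.map p.subtype q.subtype)

/-- The coboundary map `δ(x) = (ad(x)⊗id + (-1)^{|x||r₁|} id⊗ad(x)) r`, where
`c2` is the sign-twisted operator `x ↦ (-1)^{|x||·|} id⊗ad(x)`. -/
noncomputable def cobLie {K A : Type} [Field K] [AddCommGroup A] [Module K A]
    (br : A →ₗ[K] A →ₗ[K] A)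
    (c2 : A →ₗ[K] (A ⊗[K] A) →ₗ[K] (A ⊗[K] A)) (r : A ⊗[K] A) :
    A →ₗ[K] A ⊗[K] A where
  toFun x := TensorProduct.map (br x) LinearMap.id r + c2 x r
  map_add' x y := by
    simp only [map_add, TensorProduct.map_add_left, LinearMap.add_apply]
    abel
  map_smul' c x := by
    simp only [map_smul, TensorProduct.map_smul_left, LinearMap.smul_apply,
      RingHom.id_apply, smul_add]

/-- The operator `ad(x)` on `A ⊗ A ⊗ A` for `x` homogeneous of parity `p`,
with Koszul signs implemented by `ep p` (multiplication by `(-1)^{p|·|}`). -/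
noncomputable def adT3 {K A : Type} [Field K] [AddCommGroup A] [Module K A]
    (br : A →ₗ[K] A →ₗ[K] A) (ep : ZMod 2 → Module.End K A)
    (p : ZMod 2) (x : A) :
    (A ⊗[K] (A ⊗[K] A)) →ₗ[K] A ⊗[K] (A ⊗[K] A) :=
  TensorProduct.map (br x) LinearMap.id
    + TensorProduct.map (ep p) (TensorProduct.map (br x) LinearMap.id)
    + TensorProduct.map (ep p) (TensorProduct.map (ep p) (br x))

theorem sgn_zero_left' (K : Type) [Field K] (j : ZMod 2) : sgn K 0 j = 1 := by
  simp [sgn]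

theorem sgn_zero_right' (K : Type) [Field K] (j : ZMod 2) : sgn K j 0 = 1 := by
  simp [sgn]

theorem sgn_one_one' (K : Type) [Field K] : sgn K 1 1 = -1 := by
  have : (1 : ZMod 2).val = 1 := rfl
  simp [sgn, this]

theorem zmod2_cases (i : ZMod 2) : i = 0 ∨ i = 1 := by
  revert i; decide

theorem hom_ext_A {K A M : Type} [Field K] [AddCommGroup A] [Module K A]
    [AddCommGroup M] [Module K M]
    (𝒜 : ZMod 2 → Submodule K A) (hsup : 𝒜 0 ⊔ 𝒜 1 = ⊤) (f g : A →ₗ[K] M)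
    (h : ∀ i, ∀ x ∈ 𝒜 i, f x = g x) : f = g := by
  ext x
  have hx : x ∈ 𝒜 0 ⊔ 𝒜 1 := by rw [hsup]; trivial
  obtain ⟨y, hy, z, hz, rfl⟩ := Submodule.mem_sup.1 hx
  rw [map_add, map_add, h 0 y hy, h 1 z hz]

theorem hom_ext_AA {K A M : Type} [Field K] [AddCommGroup A] [Module K A]
    [AddCommGroup M] [Module K M]
    (𝒜 : ZMod 2 → Submodule K A) (hsup : 𝒜 0 ⊔ 𝒜 1 = ⊤) (f g : A ⊗[K] A →ₗ[K] M)
    (h : ∀ i j, ∀ x ∈ 𝒜 i, ∀ y ∈ 𝒜 j, f (x ⊗ₜ y) = g (x ⊗ₜ y)) : f = g := by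
  apply TensorProduct.ext
  apply hom_ext_A 𝒜 hsup
  intro i x hx
  apply hom_ext_A 𝒜 hsup
  intro j y hy
  exact h i j x hx y hy

theorem tsub_ext {K A M : Type} [Field K] [AddCommGroup A] [Module K A]
    [AddCommGroup M] [Module K M] (p q : Submodule K A) (f g : A ⊗[K] A →ₗ[K] M)
    (h : ∀ x ∈ p, ∀ y ∈ q, f (x ⊗ₜ y) = g (x ⊗ₜ y)) (r : A ⊗[K] A) (hr : r ∈ tsub K p q) :
    f r = g r := by
  obtain ⟨s, rfl⟩ := hr
  induction s with
  | zero => simp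
  | tmul x y => simpa using h x x.2 y y.2
  | add a b ha hb => simp only [map_add, ha, hb]

theorem even_ext {K A M : Type} [Field K] [AddCommGroup A] [Module K A]
    [AddCommGroup M] [Module K M]
    (𝒜 : ZMod 2 → Submodule K A) (f g : A ⊗[K] A →ₗ[K] M)
    (h : ∀ i, ∀ x ∈ 𝒜 i, ∀ y ∈ 𝒜 i, f (x ⊗ₜ y) = g (x ⊗ₜ y)) (r : A ⊗[K] A)
    (hr : r ∈ tsub K (𝒜 0) (𝒜 0) ⊔ tsub K (𝒜 1) (𝒜 1)) :
    f r = g r := by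
  obtain ⟨y, hy, z, hz, rfl⟩ := Submodule.mem_sup.1 hr
  rw [map_add, map_add, tsub_ext _ _ f g (h 0) y hy, tsub_ext _ _ f g (h 1) z hz]

theorem tmul_mem_tsub {K A : Type} [Field K] [AddCommGroup A] [Module K A]
    (p q : Submodule K A) (x y : A) (hx : x ∈ p) (hy : y ∈ q) : x ⊗ₜ[K] y ∈ tsub K p q :=
  ⟨(⟨x, hx⟩ : p) ⊗ₜ (⟨y, hy⟩ : q), by simp⟩

theorem even_mem {K A M : Type} [Field K] [AddCommGroup A] [Module K A]
    [AddCommGroup M] [Module K M]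
    (𝒜 : ZMod 2 → Submodule K A) (f : A ⊗[K] A →ₗ[K] M) (S : Submodule K M)
    (h : ∀ i, ∀ x ∈ 𝒜 i, ∀ y ∈ 𝒜 i, f (x ⊗ₜ y) ∈ S) (r : A ⊗[K] A)
    (hr : r ∈ tsub K (𝒜 0) (𝒜 0) ⊔ tsub K (𝒜 1) (𝒜 1)) : f r ∈ S := by
  have := even_ext 𝒜 (S.mkQ ∘ₗ f) 0 (by
    intro i x hx y hy
    simpa using h i x hx y hy) r hr
  simpa using this

/-- for a Lie superalgebra `(A, {,})` and an even `r ∈ A⊗A`, the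
coboundary map `δ` makes `(A, δ)` a Lie supercoalgebra iff
`(ad(x)⊗id + (-1)^{|x||r₁|}id⊗ad(x))(r + τ(r)) = 0` and `ad(x)(C(r)) = 0`
for all homogeneous `x`, where `C(r)` is the super CYBE element. -/
theorem stmt_8 {K A : Type} [Field K] [CharZero K]
    [AddCommGroup A] [Module K A]
    (𝒜 : ZMod 2 → Submodule K A) (hsup : 𝒜 0 ⊔ 𝒜 1 = ⊤)
    (br : A →ₗ[K] A →ₗ[K] A)
    -- (A, br) is a Lie superalgebra
    (hgrade : ∀ i j, ∀ x ∈ 𝒜 i, ∀ y ∈ 𝒜 j, br x y ∈ 𝒜 (i+j))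
    (hskew : ∀ i j, ∀ x ∈ 𝒜 i, ∀ y ∈ 𝒜 j, br x y = - (sgn K i j) • br y x)
    (hjac : ∀ i j k, ∀ x ∈ 𝒜 i, ∀ y ∈ 𝒜 j, ∀ z ∈ 𝒜 k,
      sgn K i k • br x (br y z) + sgn K k j • br z (br x y)
        + sgn K j i • br y (br z x) = 0)
    -- the super twist τ and the super cyclic permutation ξ
    (τ : (A ⊗[K] A) →ₗ[K] A ⊗[K] A)
    (hτ : ∀ i j, ∀ x ∈ 𝒜 i, ∀ y ∈ 𝒜 j, τ (x ⊗ₜ[K] y) = sgn K i j • (y ⊗ₜ[K] x))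
    (ξ : (A ⊗[K] (A ⊗[K] A)) →ₗ[K] A ⊗[K] (A ⊗[K] A))
    (hξ : ∀ i j k, ∀ x ∈ 𝒜 i, ∀ y ∈ 𝒜 j, ∀ z ∈ 𝒜 k,
      ξ (x ⊗ₜ[K] (y ⊗ₜ[K] z)) = (sgn K i j * sgn K i k) • (y ⊗ₜ[K] (z ⊗ₜ[K] x)))
    -- parity sign operators
    (ep : ZMod 2 → Module.End K A)
    (hep : ∀ p i, ∀ x ∈ 𝒜 i, ep p x = sgn K p i • x)
    (c2 : A →ₗ[K] (A ⊗[K] A) →ₗ[K] (A ⊗[K] A))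
    (hc2 : ∀ p i, ∀ x ∈ 𝒜 p, ∀ u ∈ 𝒜 i, ∀ v : A,
      c2 x (u ⊗ₜ[K] v) = sgn K p i • (u ⊗ₜ[K] br x v))
    -- the three super CYBE bracket builders
    (cy1 cy2 cy3 : (A ⊗[K] A) →ₗ[K] (A ⊗[K] A) →ₗ[K] A ⊗[K] (A ⊗[K] A))
    (hcy1 : ∀ j k, ∀ x : A, ∀ y ∈ 𝒜 j, ∀ z ∈ 𝒜 k, ∀ w : A,
      cy1 (x ⊗ₜ[K] y) (z ⊗ₜ[K] w) = sgn K k j • (br x z ⊗ₜ[K] (y ⊗ₜ[K] w)))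
    (hcy2 : ∀ x y z w : A,
      cy2 (x ⊗ₜ[K] y) (z ⊗ₜ[K] w) = x ⊗ₜ[K] (br y z ⊗ₜ[K] w))
    (hcy3 : ∀ j k, ∀ x : A, ∀ y ∈ 𝒜 j, ∀ z ∈ 𝒜 k, ∀ w : A,
      cy3 (x ⊗ₜ[K] y) (z ⊗ₜ[K] w) = sgn K k j • (x ⊗ₜ[K] (z ⊗ₜ[K] br y w)))
    -- r is homogeneous of even total parity
    (r : A ⊗[K] A)
    (hr : r ∈ tsub K (𝒜 0) (𝒜 0) ⊔ tsub K (𝒜 1) (𝒜 1)) :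
    -- (A, δ) is a Lie supercoalgebra
    ((∀ i, ∀ x ∈ 𝒜 i,
        cobLie br c2 r x ∈ tsub K (𝒜 0) (𝒜 i) ⊔ tsub K (𝒜 1) (𝒜 (i+1))) ∧
     (∀ x : A, ∃ u, cobLie br c2 r x = u - τ u) ∧
     (∀ x : A,
        TensorProduct.map LinearMap.id (cobLie br c2 r) (cobLie br c2 r x)
          + ξ (TensorProduct.map LinearMap.id (cobLie br c2 r) (cobLie br c2 r x))
          + ξ (ξ (TensorProduct.map LinearMap.id (cobLie br c2 r)
              (cobLie br c2 r x))) = 0))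
    ↔
    ((∀ p, ∀ x ∈ 𝒜 p,
        TensorProduct.map (br x) LinearMap.id (r + τ r) + c2 x (r + τ r) = 0) ∧
     (∀ p, ∀ x ∈ 𝒜 p,
        adT3 br ep p x (cy1 r r + cy2 r r + cy3 r r) = 0)) := by
  have z11 : (1 : ZMod 2) + 1 = 0 := by decide
  have s0 := sgn_zero_left' K
  have s0' := sgn_zero_right' K
  have s1 := sgn_one_one' K
  -- derivation form of Jacobi
  have hder : ∀ i j k, ∀ x ∈ 𝒜 i, ∀ y ∈ 𝒜 j, ∀ z ∈ 𝒜 k,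
      br x (br y z) = br (br x y) z + sgn K i j • br y (br x z) := by
    intro i j k x hx y hy z hz
    have h1 := hjac i j k x hx y hy z hz
    have h2 := hskew k (i+j) z hz _ (hgrade i j x hx y hy)
    have h3 := hskew k i z hz x hx
    rw [h2, h3] at h1
    rcases zmod2_cases i with rfl | rfl <;> rcases zmod2_cases j with rfl | rfl <;>
      rcases zmod2_cases k with rfl | rfl <;>
      simp only [s0, s0', s1, z11, add_zero, zero_add, one_smul, neg_smul, neg_neg, map_neg,
        smul_neg] at h1 ⊢ <;>
      first
        | linear_combination (norm := module) h1
        | linear_combination (norm := module) -h1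
  -- the total coboundary as a bilinear map
  have hc : ∀ (s : A ⊗[K] A) (x : A), cobLie br c2 s x
      = TensorProduct.map (br x) LinearMap.id s + c2 x s := fun _ _ => rfl
  have hττ : ∀ d, τ (τ d) = d := by
    intro d
    have : τ ∘ₗ τ = LinearMap.id := by
      apply hom_ext_AA 𝒜 hsup
      intro i j x hx y hy
      simp only [LinearMap.comp_apply, LinearMap.id_apply]
      rw [hτ i j x hx y hy, map_smul, hτ j i y hy x hx]
      rcases zmod2_cases i with rfl | rfl <;> rcases zmod2_cases j with rfl | rfl <;>
        simp [s0, s0', s1]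
    exact LinearMap.congr_fun this d
  -- τ commutes with ad x
  have hτad : ∀ (d : A ⊗[K] A) (x : A), cobLie br c2 (τ d) x = τ (cobLie br c2 d x) := by
    intro d x
    have hx : x ∈ 𝒜 0 ⊔ 𝒜 1 := by rw [hsup]; trivial
    have key : ∀ p, ∀ x ∈ 𝒜 p, cobLie br c2 (τ d) x = τ (cobLie br c2 d x) := by
      intro p x hx
      have : (TensorProduct.map (br x) LinearMap.id + c2 x) ∘ₗ τ
          = τ ∘ₗ (TensorProduct.map (br x) LinearMap.id + c2 x) := by
        apply hom_ext_AA 𝒜 hsup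
        intro i j u hu v hv
        simp only [LinearMap.comp_apply, LinearMap.add_apply, TensorProduct.map_tmul,
          LinearMap.id_apply, hτ i j u hu v hv, map_smul, hc2 p j x hx v hv, hc2 p i x hx u hu,
          map_add, hτ (p+i) j _ (hgrade p i x hx u hu) v hv,
          hτ i (p+j) u hu _ (hgrade p j x hx v hv)]
        rcases zmod2_cases i with rfl | rfl <;> rcases zmod2_cases j with rfl | rfl <;>
          rcases zmod2_cases p with rfl | rfl <;>
          simp only [s0, s0', s1, z11, add_zero, zero_add, one_smul, neg_smul, neg_neg,
            smul_neg] <;> abel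
      exact LinearMap.congr_fun this d
    have := hom_ext_A 𝒜 hsup (cobLie br c2 (τ d)) (τ ∘ₗ cobLie br c2 d) key
    exact LinearMap.congr_fun this x
  -- (0)
  have hF : ∀ s d : A ⊗[K] A, TensorProduct.map LinearMap.id (cobLie br c2 s) d
      = cy2 d s + cy3 d s := by
    intro s d
    have : TensorProduct.map LinearMap.id (cobLie br c2 s) = cy2.flip s + cy3.flip s := by
      apply hom_ext_AA 𝒜 hsup
      intro i j u hu v hv
      simp only [TensorProduct.map_tmul, LinearMap.add_apply, LinearMap.flip_apply,
        LinearMap.id_apply, hc]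
      have : (TensorProduct.mk K A (A ⊗[K] A) u) ∘ₗ
          (TensorProduct.map (br v) LinearMap.id + c2 v) = cy2 (u ⊗ₜ v) + cy3 (u ⊗ₜ v) := by
        apply hom_ext_AA 𝒜 hsup
        intro k l a ha b hb
        simp only [LinearMap.comp_apply, LinearMap.add_apply, TensorProduct.map_tmul,
          LinearMap.id_apply, TensorProduct.mk_apply, hcy2, hcy3 j k u v hv a ha,
          hc2 j k v hv a ha, TensorProduct.tmul_add, TensorProduct.tmul_smul]
        rcases zmod2_cases k with rfl | rfl <;> rcases zmod2_cases j with rfl | rfl <;>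
          simp only [s0, s0', s1]
      exact LinearMap.congr_fun this s
    exact LinearMap.congr_fun this d
  -- (2), (3)
  have h2a : ∀ d, ξ (cy2 (τ d) r) = - cy1 r d := by
    intro d
    have : ξ ∘ₗ cy2 (τ d) = - cy1.flip d → ξ (cy2 (τ d) r) = - cy1 r d :=
      fun h => LinearMap.congr_fun h r
    refine even_ext 𝒜 (ξ ∘ₗ cy2 (τ d)) (- cy1.flip d) ?_ r hr
    intro i a ha b hb
    have : ξ ∘ₗ cy2.flip (a ⊗ₜ b) ∘ₗ τ = - cy1 (a ⊗ₜ b) := by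
      apply hom_ext_AA 𝒜 hsup
      intro k l u hu v hv
      simp only [LinearMap.comp_apply, LinearMap.neg_apply, LinearMap.flip_apply,
        hτ k l u hu v hv, map_smul, hcy2, hcy1 i k a b hb u hu v, LinearMap.smul_apply,
        hξ l (k+i) i v hv _ (hgrade k i u hu a ha) b hb, hskew i k a ha u hu]
      rcases zmod2_cases k with rfl | rfl <;> rcases zmod2_cases l with rfl | rfl <;>
        rcases zmod2_cases i with rfl | rfl <;>
        simp [s0, s0', s1, z11, TensorProduct.neg_tmul]
    exact LinearMap.congr_fun this d
  have h2b : ∀ d, ξ (cy3 (τ d) r) = - cy2 r d := by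
    intro d
    refine even_ext 𝒜 (ξ ∘ₗ cy3 (τ d)) (- cy2.flip d) ?_ r hr
    intro i a ha b hb
    have : ξ ∘ₗ cy3.flip (a ⊗ₜ b) ∘ₗ τ = - cy2 (a ⊗ₜ b) := by
      apply hom_ext_AA 𝒜 hsup
      intro k l u hu v hv
      simp only [LinearMap.comp_apply, LinearMap.neg_apply, LinearMap.flip_apply,
        hτ k l u hu v hv, map_smul, hcy2, hcy3 k i v u hu a ha b, LinearMap.smul_apply,
        hξ l i (k+i) v hv a ha _ (hgrade k i u hu b hb), hskew i k b hb u hu]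
      rcases zmod2_cases k with rfl | rfl <;> rcases zmod2_cases l with rfl | rfl <;>
        rcases zmod2_cases i with rfl | rfl <;>
        simp [s0, s0', s1, z11, TensorProduct.neg_tmul, TensorProduct.tmul_neg]
    exact LinearMap.congr_fun this d
  have h3a : ∀ d, ξ (ξ (cy2 d (τ r))) = - cy3 r d := by
    intro d
    refine even_ext 𝒜 (ξ ∘ₗ ξ ∘ₗ cy2 d ∘ₗ τ) (- cy3.flip d) ?_ r hr
    intro i a ha b hb
    have : ξ ∘ₗ ξ ∘ₗ cy2.flip (τ (a ⊗ₜ b)) = - cy3 (a ⊗ₜ b) := by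
      apply hom_ext_AA 𝒜 hsup
      intro k l u hu v hv
      simp only [LinearMap.comp_apply, LinearMap.neg_apply, LinearMap.flip_apply,
        hτ i i a ha b hb, map_smul, hcy2, hcy3 i k a b hb u hu v, LinearMap.smul_apply,
        hξ k (l+i) i u hu _ (hgrade l i v hv b hb) a ha,
        hξ (l+i) i k _ (hgrade l i v hv b hb) a ha u hu, hskew i l b hb v hv]
      rcases zmod2_cases k with rfl | rfl <;> rcases zmod2_cases l with rfl | rfl <;>
        rcases zmod2_cases i with rfl | rfl <;>
        simp [s0, s0', s1, z11, TensorProduct.neg_tmul, TensorProduct.tmul_neg]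
    exact LinearMap.congr_fun this d
  have h3b : ∀ d, ξ (ξ (cy3 (τ d) (τ r))) = cy1 d r := by
    intro d
    refine even_ext 𝒜 (ξ ∘ₗ ξ ∘ₗ cy3 (τ d) ∘ₗ τ) (cy1 d) ?_ r hr
    intro i a ha b hb
    have : ξ ∘ₗ ξ ∘ₗ cy3.flip (τ (a ⊗ₜ b)) ∘ₗ τ = cy1.flip (a ⊗ₜ b) := by
      apply hom_ext_AA 𝒜 hsup
      intro k l u hu v hv
      simp only [LinearMap.comp_apply, LinearMap.neg_apply, LinearMap.flip_apply,
        hτ i i a ha b hb, hτ k l u hu v hv, map_smul, hcy3 k i v u hu b hb a,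
        hcy1 l i u v hv a ha b, LinearMap.smul_apply,
        hξ l i (k+i) v hv b hb _ (hgrade k i u hu a ha),
        hξ i (k+i) l b hb _ (hgrade k i u hu a ha) v hv]
      rcases zmod2_cases k with rfl | rfl <;> rcases zmod2_cases l with rfl | rfl <;>
        rcases zmod2_cases i with rfl | rfl <;>
        simp [s0, s0', s1, z11, TensorProduct.neg_tmul, TensorProduct.tmul_neg]
    exact LinearMap.congr_fun this d
  -- (1) derivation property of ad on the brackets
  have hD : ∀ p, ∀ x ∈ 𝒜 p, ∀ i, ∀ a ∈ 𝒜 i, ∀ b ∈ 𝒜 i, ∀ k l, ∀ u ∈ 𝒜 k, ∀ v ∈ 𝒜 l,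
      adT3 br ep p x (cy1 (a ⊗ₜ b) (u ⊗ₜ v)) = cy1 (cobLie br c2 (a ⊗ₜ b) x) (u ⊗ₜ v)
        + cy1 (a ⊗ₜ b) (cobLie br c2 (u ⊗ₜ v) x) ∧
      adT3 br ep p x (cy2 (a ⊗ₜ b) (u ⊗ₜ v)) = cy2 (cobLie br c2 (a ⊗ₜ b) x) (u ⊗ₜ v)
        + cy2 (a ⊗ₜ b) (cobLie br c2 (u ⊗ₜ v) x) ∧
      adT3 br ep p x (cy3 (a ⊗ₜ b) (u ⊗ₜ v)) = cy3 (cobLie br c2 (a ⊗ₜ b) x) (u ⊗ₜ v)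
        + cy3 (a ⊗ₜ b) (cobLie br c2 (u ⊗ₜ v) x) := by
    intro p x hx i a ha b hb k l u hu v hv
    have xa := hgrade p i x hx a ha
    have xb := hgrade p i x hx b hb
    have xu := hgrade p k x hx u hu
    refine ⟨?_, ?_, ?_⟩
    · simp only [hc, TensorProduct.map_tmul, LinearMap.id_apply, hc2 p i x hx a ha,
        hc2 p k x hx u hu, map_add, map_smul, LinearMap.add_apply, LinearMap.smul_apply,
        hcy1 i k _ b hb u hu, hcy1 (p+i) k _ _ xb u hu, hcy1 i (p+k) _ b hb _ xu, adT3,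
        hep p (i+k) _ (hgrade i k a ha u hu), hep p i b hb, hder p i k x hx a ha u hu]
      rcases zmod2_cases k with rfl | rfl <;> rcases zmod2_cases p with rfl | rfl <;>
        rcases zmod2_cases i with rfl | rfl <;>
        simp only [s0, s0', s1, z11, add_zero, zero_add, one_smul, neg_smul, neg_neg,
          smul_neg, TensorProduct.neg_tmul, TensorProduct.tmul_neg, TensorProduct.add_tmul,
          TensorProduct.tmul_add] <;> abel
    · simp only [hc, TensorProduct.map_tmul, LinearMap.id_apply, hc2 p i x hx a ha,
        hc2 p k x hx u hu, map_add, map_smul, LinearMap.add_apply, LinearMap.smul_apply,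
        hcy2, adT3,
        hep p (i+k) _ (hgrade i k b hb u hu), hep p i a ha, hder p i k x hx b hb u hu]
      rcases zmod2_cases k with rfl | rfl <;> rcases zmod2_cases p with rfl | rfl <;>
        rcases zmod2_cases i with rfl | rfl <;>
        simp only [s0, s0', s1, z11, add_zero, zero_add, one_smul, neg_smul, neg_neg,
          smul_neg, TensorProduct.neg_tmul, TensorProduct.tmul_neg, TensorProduct.add_tmul,
          TensorProduct.tmul_add] <;> abel
    · simp only [hc, TensorProduct.map_tmul, LinearMap.id_apply, hc2 p i x hx a ha,
        hc2 p k x hx u hu, map_add, map_smul, LinearMap.add_apply, LinearMap.smul_apply,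
        hcy3 i k _ b hb u hu, hcy3 (p+i) k _ _ xb u hu, hcy3 i (p+k) _ b hb _ xu, adT3,
        hep p k u hu, hep p i a ha, hder p i l x hx b hb v hv]
      rcases zmod2_cases k with rfl | rfl <;> rcases zmod2_cases p with rfl | rfl <;>
        rcases zmod2_cases i with rfl | rfl <;>
        simp only [s0, s0', s1, z11, add_zero, zero_add, one_smul, neg_smul, neg_neg,
          smul_neg, TensorProduct.neg_tmul, TensorProduct.tmul_neg, TensorProduct.add_tmul,
          TensorProduct.tmul_add] <;> abel
  have hD' : ∀ (cy : (A ⊗[K] A) →ₗ[K] (A ⊗[K] A) →ₗ[K] A ⊗[K] (A ⊗[K] A)) (p : ZMod 2) (x : A),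
      (∀ i, ∀ a ∈ 𝒜 i, ∀ b ∈ 𝒜 i, ∀ k l, ∀ u ∈ 𝒜 k, ∀ v ∈ 𝒜 l,
      adT3 br ep p x (cy (a ⊗ₜ b) (u ⊗ₜ v)) = cy (cobLie br c2 (a ⊗ₜ b) x) (u ⊗ₜ v)
        + cy (a ⊗ₜ b) (cobLie br c2 (u ⊗ₜ v) x)) →
      adT3 br ep p x (cy r r) = cy (cobLie br c2 r x) r + cy r (cobLie br c2 r x) := by
    intro cy p x h
    let D : (A ⊗[K] A) →ₗ[K] (A ⊗[K] A) := TensorProduct.map (br x) LinearMap.id + c2 x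
    refine even_ext 𝒜 (adT3 br ep p x ∘ₗ cy.flip r) (cy.flip r ∘ₗ D + cy.flip (D r)) ?_ r hr
    intro i a ha b hb
    have : adT3 br ep p x ∘ₗ cy (a ⊗ₜ b) = cy (D (a ⊗ₜ b)) + cy (a ⊗ₜ b) ∘ₗ D := by
      apply hom_ext_AA 𝒜 hsup
      intro k l u hu v hv
      exact h i a ha b hb k l u hu v hv
    exact LinearMap.congr_fun this r
  have hgr : ∀ i, ∀ x ∈ 𝒜 i,
        cobLie br c2 r x ∈ tsub K (𝒜 0) (𝒜 i) ⊔ tsub K (𝒜 1) (𝒜 (i+1)) := by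
    intro p x hx
    refine even_mem 𝒜 (TensorProduct.map (br x) LinearMap.id + c2 x) _ ?_ r hr
    intro i a ha b hb
    have xa := hgrade p i x hx a ha
    have xb := hgrade p i x hx b hb
    simp only [LinearMap.add_apply, TensorProduct.map_tmul, LinearMap.id_apply,
      hc2 p i x hx a ha]
    rcases zmod2_cases p with rfl | rfl <;> rcases zmod2_cases i with rfl | rfl <;>
      simp only [z11, add_zero, zero_add] at xa xb ⊢ <;>
      refine Submodule.add_mem _ ?_ (Submodule.smul_mem _ _ ?_) <;>
      first
        | exact Submodule.mem_sup_left (tmul_mem_tsub _ _ _ _ (by assumption) (by assumption))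
        | exact Submodule.mem_sup_right (tmul_mem_tsub _ _ _ _ (by assumption) (by assumption))
  -- skew-symmetry
  have hcadd : ∀ x, cobLie br c2 (r + τ r) x = cobLie br c2 r x + τ (cobLie br c2 r x) := by
    intro x
    rw [← hτad]
    simp only [hc, map_add]
    abel
  have hsk : (∀ x : A, ∃ u, cobLie br c2 r x = u - τ u) ↔
      (∀ p, ∀ x ∈ 𝒜 p,
        TensorProduct.map (br x) LinearMap.id (r + τ r) + c2 x (r + τ r) = 0) := by
    constructor
    · intro h p x _
      rw [← hc, hcadd]
      obtain ⟨u, hu⟩ := h x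
      rw [hu, map_sub, hττ]
      abel
    · intro h x
      have h0 := LinearMap.congr_fun (hom_ext_A 𝒜 hsup (cobLie br c2 (r + τ r)) 0 h) x
      rw [hcadd, LinearMap.zero_apply] at h0
      refine ⟨(2⁻¹ : K) • cobLie br c2 r x, ?_⟩
      rw [map_smul, ← smul_sub, ← neg_eq_of_add_eq_zero_right h0, sub_neg_eq_add, ← two_smul K,
        smul_smul, inv_mul_cancel₀ two_ne_zero, one_smul]
  rw [hsk]
  have main : (∀ p, ∀ x ∈ 𝒜 p,
        TensorProduct.map (br x) LinearMap.id (r + τ r) + c2 x (r + τ r) = 0) →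
      ∀ p, ∀ x ∈ 𝒜 p, 
        TensorProduct.map LinearMap.id (cobLie br c2 r) (cobLie br c2 r x)
          + ξ (TensorProduct.map LinearMap.id (cobLie br c2 r) (cobLie br c2 r x))
          + ξ (ξ (TensorProduct.map LinearMap.id (cobLie br c2 r)
              (cobLie br c2 r x))) = adT3 br ep p x (cy1 r r + cy2 r r + cy3 r r) := by
    intro h p x hx
    have ht : cobLie br c2 (r + τ r) = 0 := hom_ext_A 𝒜 hsup (cobLie br c2 (r + τ r)) 0 h
    have h0 := LinearMap.congr_fun ht x
    rw [hcadd, LinearMap.zero_apply] at h0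
    rw [map_add, map_add,
      hD' cy1 p x (fun i a ha b hb k l u hu v hv => (hD p x hx i a ha b hb k l u hu v hv).1),
      hD' cy2 p x (fun i a ha b hb k l u hu v hv => (hD p x hx i a ha b hb k l u hu v hv).2.1),
      hD' cy3 p x (fun i a ha b hb k l u hu v hv => (hD p x hx i a ha b hb k l u hu v hv).2.2)]
    generalize cobLie br c2 r x = d at h0 ⊢
    have hd : τ d = - d := by rw [← neg_eq_of_add_eq_zero_right h0]
    have e1 := h2a d
    have e2 := h2b d
    have e3 := h3a d
    have e4 := h3b d
    have e5 := hF (r + τ r) d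
    rw [ht] at e5
    simp only [TensorProduct.map_zero_right, LinearMap.zero_apply, map_add] at e5
    have e6 := congrArg (fun z => ξ (ξ z)) e5
    simp only [map_add, map_zero] at e6
    simp only [hd, map_neg, LinearMap.neg_apply, neg_inj] at e1 e2 e4
    simp only [hF, map_add]
    linear_combination (norm := module) e1 + e2 - e6 - e3 + e4
  constructor
  · rintro ⟨_, h, hJ⟩
    refine ⟨h, fun p x hx => ?_⟩
    rw [← main h p x hx]
    exact hJ x
  · rintro ⟨h, hJ⟩
    refine ⟨hgr, h, fun x => ?_⟩
    let F := TensorProduct.map LinearMap.id (cobLie br c2 r) ∘ₗ cobLie br c2 r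
    have := hom_ext_A 𝒜 hsup (F + ξ ∘ₗ F + ξ ∘ₗ ξ ∘ₗ F) 0
      (fun p x hx => (main h p x hx).trans (hJ p x hx))
    exact LinearMap.congr_fun this x
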